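/- For every non-negative integer L, \(\sum_{j=-\infty}^{\infty} (-1)^j \left(\frac{j+1}{3}\right) q^{\binom{j}{2}} \binom{2L+1}{L-j}_q = \frac{(q^3;q^3)_{L-1}}{(q;q)_{L-1}}\,\bigl(2 + q^L(1+q) - q^{2L+1}\bigr)\) when L > 0, and the sum equals 1 when L = 0. The sum is finite since the q-binomial coefficient vanishes for j < -(L+1) and j > L. -/

import Mathlib

open Finset

/-- The finite q-Pochhammer symbol `(a;q)_n`. -/
noncomputable def qPoch (a q : RatFunc ℚ) (n : ℕ) : RatFunc ℚ :=
  ∏ k ∈ Finset.range n, (1 - a * q ^ k)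

/-- The q-binomial coefficient `[top choose bot]_q`, zero unless `0 ≤ bot ≤ top`. -/
noncomputable def qBinom (q : RatFunc ℚ) (top bot : ℤ) : RatFunc ℚ :=
  if 0 ≤ bot ∧ bot ≤ top then
    qPoch q q top.toNat / (qPoch q q bot.toNat * qPoch q q (top - bot).toNat)
  else 0

/-- The Legendre symbol modulo 3. -/
def leg3 (j : ℤ) : ℤ := if j % 3 = 1 then 1 else if j % 3 = 2 then -1 else 0

/-- `1/(q;q)_k`, with the convention that it is zero for negative `k`. -/
noncomputable def invPoch (q : RatFunc ℚ) (k : ℤ) : RatFunc ℚ :=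
  if 0 ≤ k then (qPoch q q k.toNat)⁻¹ else 0

/-- The generic variable `q` in the field of rational functions. -/
noncomputable def Xq : RatFunc ℚ := RatFunc.X

/-- q-Pascal recursion for Gaussian binomials. -/
noncomputable def gb (q : RatFunc ℚ) : ℕ → ℕ → RatFunc ℚ
  | _, 0 => 1
  | 0, _ + 1 => 0
  | n + 1, k + 1 => gb q n k + q ^ (k + 1) * gb q n (k + 1)

theorem gb_gt (q : RatFunc ℚ) : ∀ n k, n < k → gb q n k = 0 := by
  intro n
  induction n with
  | zero => intro k hk; obtain ⟨k, rfl⟩ := Nat.exists_eq_succ_of_ne_zero hk.ne'; simp [gb]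
  | succ n ih =>
    intro k hk
    obtain ⟨k, rfl⟩ : ∃ m, k = m + 1 := ⟨k - 1, by omega⟩
    rw [gb, ih k (by omega), ih (k + 1) (by omega)]; simp

theorem qPoch_succ' (q : RatFunc ℚ) (n : ℕ) :
    qPoch q q (n + 1) = qPoch q q n * (1 - q ^ (n + 1)) := by
  unfold qPoch
  rw [Finset.prod_range_succ, pow_succ' q n]

theorem gb_self (q : RatFunc ℚ) (n : ℕ) : gb q n n = 1 := by
  induction n with
  | zero => simp [gb]
  | succ n ih => rw [gb, ih, gb_gt q n (n + 1) (by omega)]; simp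

theorem gb_poch (q : RatFunc ℚ) : ∀ s a b : ℕ, a + b = s →
    gb q (a + b) a * (qPoch q q a * qPoch q q b) = qPoch q q (a + b) := by
  intro s
  induction s with
  | zero =>
    intro a b h
    obtain ⟨rfl, rfl⟩ : a = 0 ∧ b = 0 := by omega
    simp [gb, qPoch]
  | succ s ih =>
    intro a b h
    rcases a with _ | a
    · simp [gb, qPoch]
    rcases b with _ | b
    · simp [gb_self, qPoch]
    have h1 := ih a (b + 1) (by omega)
    have h2 := ih (a + 1) b (by omega)
    have e2 : a + 1 + b = a + (b + 1) := by omega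
    rw [e2] at h2
    have e : a + 1 + (b + 1) = (a + (b + 1)) + 1 := by omega
    rw [e, gb, qPoch_succ' q (a + (b + 1))]
    have p1 := qPoch_succ' q a
    have p2 := qPoch_succ' q b
    have : q ^ (a + (b + 1) + 1) = q ^ (a + 1) * q ^ (b + 1) := by rw [← pow_add]; congr 1; omega
    rw [this]
    calc _ = (1 - q ^ (a + 1)) * (gb q (a + (b + 1)) a * (qPoch q q a * qPoch q q (b + 1)))
          + q ^ (a + 1) * (1 - q ^ (b + 1)) *
            (gb q (a + (b + 1)) (a + 1) * (qPoch q q (a + 1) * qPoch q q b)) := by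
          rw [p1, p2]; ring
      _ = _ := by rw [h1, h2]; ring

theorem X_pow_ne (n : ℕ) : (1 : RatFunc ℚ) - Xq ^ (n + 1) ≠ 0 := by
  intro h
  have h1 : (algebraMap (Polynomial ℚ) (RatFunc ℚ)) (1 - Polynomial.X ^ (n + 1)) = 0 := by
    simpa [Xq] using h
  have h2 := (map_eq_zero_iff _ (RatFunc.algebraMap_injective ℚ)).1 h1
  have h3 := congrArg (Polynomial.eval 0) h2
  simp at h3

theorem qPoch_ne (n : ℕ) : qPoch Xq Xq n ≠ 0 := by
  induction n with
  | zero => simp [qPoch]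
  | succ n ih => rw [qPoch_succ']; exact mul_ne_zero ih (X_pow_ne n)

theorem qbinomial {F : Type*} [Field F] [Algebra (RatFunc ℚ) F] (q : RatFunc ℚ) (n : ℕ) :
    ∀ x : F, ∏ k ∈ Finset.range n, (1 + x * (algebraMap _ F q) ^ k) =
      ∑ k ∈ Finset.range (n + 1), (algebraMap _ F q) ^ (k.choose 2) *
        algebraMap _ F (gb q n k) * x ^ k := by
  induction n with
  | zero => intro x; simp [gb]
  | succ n ih =>
    intro x
    set Q := algebraMap _ F q with hQ
    rw [Finset.prod_range_succ']
    have h := ih (x * Q)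
    have e : ∏ k ∈ Finset.range n, (1 + x * Q ^ (k + 1)) =
        ∏ k ∈ Finset.range n, (1 + x * Q * Q ^ k) := by
      refine Finset.prod_congr rfl fun k _ => ?_
      ring
    rw [e, h, Finset.sum_range_succ' _ (n + 1)]
    have e2 : ∑ k ∈ Finset.range (n + 1), Q ^ ((k + 1).choose 2) *
        algebraMap _ F (gb q (n + 1) (k + 1)) * x ^ (k + 1) =
        x * (∑ k ∈ Finset.range (n + 1), Q ^ (k.choose 2) *
          algebraMap _ F (gb q n k) * (x * Q) ^ k) +
        ∑ k ∈ Finset.range (n + 1), Q ^ ((k + 1).choose 2) *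
          algebraMap _ F (gb q n (k + 1)) * (x * Q) ^ (k + 1) := by
      rw [Finset.mul_sum, ← Finset.sum_add_distrib]
      refine Finset.sum_congr rfl fun k _ => ?_
      have : (k + 1).choose 2 = k + k.choose 2 := by
        rw [Nat.choose_succ_succ' k 1]; simp
      rw [gb, map_add, map_mul, map_pow, ← hQ, this]
      ring
    have e3 : ∑ k ∈ Finset.range (n + 1), Q ^ (k.choose 2) *
          algebraMap _ F (gb q n k) * (x * Q) ^ k =
        (∑ k ∈ Finset.range (n + 1), Q ^ ((k + 1).choose 2) *
          algebraMap _ F (gb q n (k + 1)) * (x * Q) ^ (k + 1)) + 1 := by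
      have := Finset.sum_range_succ' (fun k => Q ^ (k.choose 2) *
          algebraMap _ F (gb q n k) * (x * Q) ^ k) (n + 1)
      rw [Finset.sum_range_succ] at this
      rw [gb_gt q n (n + 1) (by omega)] at this
      simpa [gb] using this
    rw [e2]
    rw [mul_add, e3]
    simp [gb]
    ring

theorem prodneg {F : Type*} [Field F] (q z : F) (hq : q ≠ 0) (hz : z ≠ 0) (M : ℕ) :
    ((-z) ^ M)⁻¹ * q ^ ((M + 1).choose 2) *
      ∏ k ∈ Finset.range M, (1 - z * (q ^ M)⁻¹ * q ^ k) =
    ∏ m ∈ Finset.range M, (1 - z⁻¹ * q ^ (m + 1)) := by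
  induction M with
  | zero => simp
  | succ M ih =>
    rw [Finset.prod_range_succ', Finset.prod_range_succ, ← ih]
    have e : ∏ k ∈ Finset.range M, (1 - z * (q ^ (M + 1))⁻¹ * q ^ (k + 1)) =
        ∏ k ∈ Finset.range M, (1 - z * (q ^ M)⁻¹ * q ^ k) := by
      refine Finset.prod_congr rfl fun k _ => ?_
      rw [pow_succ q M, pow_succ q k]
      field_simp
    have c : (M + 1 + 1).choose 2 = (M + 1) + (M + 1).choose 2 := by
      rw [Nat.choose_succ_succ' (M + 1) 1]; simp
    rw [e, c]
    generalize ∏ k ∈ Finset.range M, (1 - z * (q ^ M)⁻¹ * q ^ k) = P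
    have hz' : (-z) ^ M ≠ 0 := pow_ne_zero _ (neg_ne_zero.2 hz)
    rw [pow_succ (-z) M, pow_add q (M + 1)]
    generalize (-z) ^ M = W at *
    field_simp
    ring

theorem jtp {F : Type*} [Field F] [Algebra (RatFunc ℚ) F] (q : RatFunc ℚ) (hq : q ≠ 0) (z : F)
    (hz : z ≠ 0) (L : ℕ) :
    ∑ j ∈ Finset.Icc (-(L : ℤ) - 1) (L : ℤ),
      (-1 : F) ^ j * z ^ j * (algebraMap _ F q) ^ (j * (j - 1) / 2) *
        algebraMap _ F (gb q (2 * L + 1) (j + L + 1).toNat) =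
    (∏ k ∈ Finset.range L, (1 - z * (algebraMap _ F q) ^ k)) *
      ∏ m ∈ Finset.range (L + 1), (1 - z⁻¹ * (algebraMap _ F q) ^ (m + 1)) := by
  have hQ0 : algebraMap _ F q ≠ 0 := by simpa using hq
  have hb := qbinomial q (2 * L + 1) (-z * ((algebraMap _ F q) ^ (L + 1))⁻¹)
  set Q := algebraMap _ F q with hQ
  rw [show 2 * L + 1 = (L + 1) + L by ring, Finset.prod_range_add] at hb
  have s1 : ∏ k ∈ Finset.range L, (1 - z * Q ^ k) =
      ∏ k ∈ Finset.range L, (1 + -z * (Q ^ (L + 1))⁻¹ * Q ^ (L + 1 + k)) := by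
    refine Finset.prod_congr rfl fun k _ => ?_
    rw [pow_add Q (L + 1) k]
    field_simp
    ring
  have s2 : ∏ k ∈ Finset.range (L + 1), (1 - z * (Q ^ (L + 1))⁻¹ * Q ^ k) =
      ∏ k ∈ Finset.range (L + 1), (1 + -z * (Q ^ (L + 1))⁻¹ * Q ^ k) := by
    refine Finset.prod_congr rfl fun k _ => ?_
    ring
  rw [← prodneg Q z hQ0 hz (L + 1), s1, s2, mul_left_comm, mul_comm (∏ k ∈ Finset.range L, _), hb,
    Finset.mul_sum]
  refine Finset.sum_nbij' (fun j => (j + L + 1).toNat) (fun k => (k : ℤ) - (L + 1)) ?_ ?_ ?_ ?_ ?_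
  · intro j hj; simp only [Finset.mem_Icc, Finset.mem_range] at *; omega
  · intro j hj; simp only [Finset.mem_Icc, Finset.mem_range] at *; omega
  · intro j hj; simp only [Finset.mem_Icc] at *; omega
  · intro j hj; omega
  · intro j hj
    simp only [Finset.mem_Icc] at hj
    obtain ⟨k, hk⟩ : ∃ k : ℕ, j = (k : ℤ) - ((L + 1 : ℕ) : ℤ) := ⟨(j + L + 1).toNat, by omega⟩
    have hk' : (j + L + 1).toNat = k := by omega
    rw [hk', show (L + 1) + L = 2 * L + 1 by ring]
    have c2 : ∀ n : ℕ, (2 : ℤ) * ((n.choose 2 : ℕ) : ℤ) = n * (n - 1) := by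
      intro n
      induction n with
      | zero => simp
      | succ n ih =>
        rw [Nat.choose_succ_succ' n 1]; push_cast; simp; linarith
    have he : j * (j - 1) / 2 = ((L + 1 + 1).choose 2 : ℕ) + ((k.choose 2 : ℕ) : ℤ)
        - ((L + 1) * k : ℕ) := by
      have h1 := c2 (L + 1 + 1)
      have h2 := c2 k
      apply Int.ediv_eq_of_eq_mul_right (by norm_num)
      rw [hk]
      push_cast at *
      linear_combination -h1 - h2
    rw [he, ← mul_zpow, hk, zpow_sub₀ (by simpa using hz), zpow_sub₀ hQ0, zpow_add₀ hQ0]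
    simp only [zpow_natCast, mul_pow, inv_pow, ← pow_mul, neg_one_mul]
    field_simp

theorem leg_omega {F : Type*} [Field F] (z : F) (hz : z ^ 2 + z + 1 = 0) (hz0 : z ≠ 0) (j : ℤ) :
    (leg3 j : F) * (z - z⁻¹) = z ^ j - (z⁻¹) ^ j := by
  have h3 : z ^ (3 : ℤ) = 1 := by
    have : z ^ 3 = 1 := by linear_combination (z - 1) * hz
    exact_mod_cast this
  have hi : z⁻¹ = z ^ 2 := by
    symm
    apply eq_inv_of_mul_eq_one_left
    linear_combination (z - 1) * hz
  have hm : z ^ j = z ^ (j % 3) := by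
    conv_lhs => rw [← Int.emod_add_mul_ediv j 3]
    rw [zpow_add₀ hz0, zpow_mul, h3]; simp
  rw [inv_zpow, hm]
  have h0 : 0 ≤ j % 3 := by omega
  have h1 : j % 3 < 3 := by omega
  unfold leg3
  generalize j % 3 = r at *
  have h4 : z ^ 4 = z := by linear_combination (z ^ 2 - z) * hz
  interval_cases r
  · simp
  · simp
  · have : z ^ (2 : ℤ) = z ^ 2 := by norm_cast
    rw [this, ← inv_pow, hi]; simp
    linear_combination -h4

theorem cubeprod {F : Type*} [Field F] [Algebra (RatFunc ℚ) F] (n : ℕ) (z : F)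
    (hz : z ^ 2 + z + 1 = 0) (hz0 : z ≠ 0) :
    algebraMap _ F (qPoch (Xq ^ 3) (Xq ^ 3) n / qPoch Xq Xq n) =
      ∏ k ∈ Finset.range n, ((1 - z * (algebraMap _ F Xq) ^ (k + 1)) *
        (1 - z⁻¹ * (algebraMap _ F Xq) ^ (k + 1))) := by
  unfold qPoch
  rw [← Finset.prod_div_distrib, map_prod]
  refine Finset.prod_congr rfl fun k _ => ?_
  have hx := X_pow_ne k
  have h : (1 - Xq ^ 3 * (Xq ^ 3) ^ k) / (1 - Xq * Xq ^ k) =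
      1 + Xq ^ (k + 1) + (Xq ^ (k + 1)) ^ 2 := by
    rw [← pow_succ', ← pow_succ', div_eq_iff hx, ← pow_mul, mul_comm 3, pow_mul]
    ring
  rw [h]
  simp only [map_add, map_one, map_pow]
  have hzi : z + z⁻¹ = -1 := by
    field_simp
    linear_combination hz
  have hm : z * z⁻¹ = 1 := mul_inv_cancel₀ hz0
  generalize (algebraMap _ F Xq) ^ (k + 1) = Q
  linear_combination Q * hzi - Q ^ 2 * hm

theorem qBinom_gb (L : ℕ) (j : ℤ) (hj : j ∈ Finset.Icc (-(L : ℤ) - 1) (L : ℤ)) :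
    qBinom Xq (2 * L + 1) ((L : ℤ) - j) = gb Xq (2 * L + 1) (j + L + 1).toNat := by
  simp only [Finset.mem_Icc] at hj
  unfold qBinom
  rw [if_pos (by omega)]
  obtain ⟨a, ha⟩ : ∃ a : ℕ, (a : ℤ) = j + L + 1 := ⟨(j + L + 1).toNat, by omega⟩
  obtain ⟨b, hb⟩ : ∃ b : ℕ, (b : ℤ) = L - j := ⟨(L - j).toNat, by omega⟩
  have e1 : (2 * (L : ℤ) + 1).toNat = a + b := by omega
  have e2 : 2 * L + 1 = a + b := by omega
  have e3 : (2 * (L : ℤ) + 1 - (L - j)).toNat = a := by omega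
  rw [e1, e2, e3, ← ha, ← hb]
  simp only [Int.toNat_natCast]
  rw [div_eq_iff (mul_ne_zero (qPoch_ne _) (qPoch_ne _)), ← gb_poch Xq _ a b rfl]
  ring

theorem jtp_omega {F : Type*} [Field F] [Algebra (RatFunc ℚ) F] (z : F)
    (hz : z ^ 2 + z + 1 = 0) (hz0 : z ≠ 0) (n : ℕ) :
    (∏ k ∈ Finset.range (n + 1), (1 - z * (algebraMap _ F Xq) ^ k)) *
      ∏ m ∈ Finset.range (n + 1 + 1), (1 - z⁻¹ * (algebraMap _ F Xq) ^ (m + 1)) =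
    algebraMap _ F (qPoch (Xq ^ 3) (Xq ^ 3) n / qPoch Xq Xq n) * ((1 - z) *
      (1 - z⁻¹ * (algebraMap _ F Xq) ^ (n + 1)) * (1 - z⁻¹ * (algebraMap _ F Xq) ^ (n + 2))) := by
  rw [cubeprod n z hz hz0, Finset.prod_range_succ', Finset.prod_range_succ,
    Finset.prod_range_succ, Finset.prod_mul_distrib]
  ring

/-- Identity (3.1): for `L ≥ 0`,
`∑_j (-1)^j ((j+1)/3) q^{binom(j,2)} [2L+1 choose L-j]_q` equals
`((q³;q³)_{L-1}/(q;q)_{L-1}) (2 + q^L(1+q) - q^{2L+1})` for `L > 0`, and `1` for `L = 0`.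
The sum is taken over `-(L+1) ≤ j ≤ L`, which covers all nonzero terms. -/
theorem statement19 (L : ℕ) :
    ∑ j ∈ Finset.Icc (-(L : ℤ) - 1) (L : ℤ),
      (-1 : RatFunc ℚ) ^ j * (leg3 (j + 1) : RatFunc ℚ) * Xq ^ (j * (j - 1) / 2) *
        qBinom Xq (2 * L + 1) ((L : ℤ) - j) =
    if L = 0 then 1 else
      qPoch (Xq ^ 3) (Xq ^ 3) (L - 1) / qPoch Xq Xq (L - 1) *
        (2 + Xq ^ L * (1 + Xq) - Xq ^ (2 * L + 1)) := by
  obtain ⟨z, hz⟩ : ∃ z : AlgebraicClosure (RatFunc ℚ), z ^ 2 + z + 1 = 0 := by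
    obtain ⟨s, hs⟩ := IsAlgClosed.exists_pow_nat_eq
      (-3 : AlgebraicClosure (RatFunc ℚ)) (n := 2) (by norm_num)
    refine ⟨(s - 1) / 2, ?_⟩
    have h2 : (2 : AlgebraicClosure (RatFunc ℚ)) ≠ 0 := two_ne_zero
    field_simp
    linear_combination hs
  have hz0 : z ≠ 0 := by rintro rfl; simp at hz
  have hm : z * z⁻¹ = 1 := mul_inv_cancel₀ hz0
  have hzi : z + z⁻¹ = -1 := by
    field_simp
    linear_combination hz
  have hw0 : z⁻¹ ≠ 0 := inv_ne_zero hz0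
  have hw : z⁻¹ ^ 2 + z⁻¹ + 1 = 0 := by
    linear_combination z⁻¹ * hzi - hm
  have hd : z - z⁻¹ ≠ 0 := by
    intro h
    have : (3 : AlgebraicClosure (RatFunc ℚ)) = 0 := by
      linear_combination -(z - z⁻¹) * h + (z + z⁻¹ - 1) * hzi - 4 * hm
    norm_num at this
  have hX : Xq ≠ 0 := RatFunc.X_ne_zero
  apply (algebraMap (RatFunc ℚ) (AlgebraicClosure (RatFunc ℚ))).injective
  apply mul_right_cancel₀ hd
  have j1 := jtp Xq hX z hz0 L
  have j2 := jtp Xq hX z⁻¹ hw0 L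
  have key : algebraMap (RatFunc ℚ) (AlgebraicClosure (RatFunc ℚ))
      (∑ j ∈ Finset.Icc (-(L : ℤ) - 1) (L : ℤ),
      (-1 : RatFunc ℚ) ^ j * (leg3 (j + 1) : RatFunc ℚ) * Xq ^ (j * (j - 1) / 2) *
        qBinom Xq (2 * L + 1) ((L : ℤ) - j)) * (z - z⁻¹) =
      z * (∑ j ∈ Finset.Icc (-(L : ℤ) - 1) (L : ℤ),
      (-1 : AlgebraicClosure (RatFunc ℚ)) ^ j * z ^ j *
        (algebraMap (RatFunc ℚ) (AlgebraicClosure (RatFunc ℚ)) Xq) ^ (j * (j - 1) / 2) *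
        algebraMap (RatFunc ℚ) (AlgebraicClosure (RatFunc ℚ))
          (gb Xq (2 * L + 1) (j + L + 1).toNat)) - z⁻¹ * (∑ j ∈ Finset.Icc (-(L : ℤ) - 1) (L : ℤ),
      (-1 : AlgebraicClosure (RatFunc ℚ)) ^ j * z⁻¹ ^ j *
        (algebraMap (RatFunc ℚ) (AlgebraicClosure (RatFunc ℚ)) Xq) ^ (j * (j - 1) / 2) *
        algebraMap (RatFunc ℚ) (AlgebraicClosure (RatFunc ℚ))
          (gb Xq (2 * L + 1) (j + L + 1).toNat)) := by
    rw [map_sum, Finset.sum_mul, Finset.mul_sum, Finset.mul_sum,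
      ← Finset.sum_sub_distrib]
    refine Finset.sum_congr rfl fun j hj => ?_
    rw [qBinom_gb L j hj]
    simp only [map_mul, map_zpow₀, map_neg, map_one, map_intCast]
    have h := leg_omega z hz hz0 (j + 1)
    rw [zpow_add_one₀ hz0, zpow_add_one₀ hw0] at h
    generalize algebraMap (RatFunc ℚ) (AlgebraicClosure (RatFunc ℚ))
      (gb Xq (2 * L + 1) (j + L + 1).toNat) = B
    generalize algebraMap (RatFunc ℚ) (AlgebraicClosure (RatFunc ℚ)) Xq ^ (j * (j - 1) / 2) = C
    linear_combination (-1) ^ j * C * B * h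
  rw [key, j1, j2]
  rcases L with _ | n
  · simp
    linear_combination 0 * hm
  · have o2 := jtp_omega z⁻¹ hw hw0 n
    rw [jtp_omega z hz hz0 n, o2, if_neg (by omega), inv_inv]
    simp only [Nat.add_sub_cancel]
    rw [map_mul]
    simp only [map_sub, map_add, map_mul, map_pow, map_one, map_ofNat]
    generalize algebraMap (RatFunc ℚ) (AlgebraicClosure (RatFunc ℚ))
      (qPoch (Xq ^ 3) (Xq ^ 3) n / qPoch Xq Xq n) = P
    generalize algebraMap (RatFunc ℚ) (AlgebraicClosure (RatFunc ℚ)) Xq = Q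
    have hwz : z⁻¹ = -1 - z := by linear_combination hzi
    rw [hwz, show 2 * (n + 1) + 1 = (n + 1) + (n + 1) + 1 by ring, show n + 2 = (n + 1) + 1 by ring,
      pow_succ Q (n + 1), pow_succ Q (n + 1 + (n + 1)), pow_add Q (n + 1) (n + 1)]
    generalize Q ^ (n + 1) = Y
    have hz2 : z ^ 2 = -1 - z := by linear_combination hz
    have hz3 : z ^ 3 = 1 := by linear_combination (z - 1) * hz
    have hz4 : z ^ 4 = z := by linear_combination (z ^ 2 - z) * hz
    ring_nf
    simp only [hz2, hz3, hz4]
    ring
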